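/- Over Kripke structures, the logics ICPDL, CPDL⁺(TW₁) and CPDL⁺(TW₂) are pairwise equi-expressive: in each direction there is a (polynomial-time computable) translation mapping formulas to formulas and programs to programs that preserves semantic equivalence on all Kripke structures. -/

import Mathlib

namespace PaperCPDL

/-- Relational structures over a fixed countably infinite signature:
for every arity `n` there are countably many relation names, indexed by `ℕ`. -/
structure Struct : Type 1 where
  World : Type
  rel : (n : ℕ) → ℕ → (Fin n → World) → Prop

namespace Struct

variable (K : Struct)

/-- Atomic propositions are the unary relation names. -/
def prop (p : ℕ) (w : K.World) : Prop := K.rel 1 p fun _ => w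

/-- Atomic programs are the binary relation names. -/
def prog (a : ℕ) (u v : K.World) : Prop :=
  K.rel 2 a fun i => if (i : ℕ) = 0 then u else v

/-- A Kripke structure interprets every relation of arity `> 2` as the empty relation. -/
def IsKripke : Prop := ∀ n, 2 < n → ∀ r (t : Fin n → K.World), ¬ K.rel n r t

/-- Gaifman adjacency: `u` and `v` occur together in a tuple of some relation. -/
def gadj (u v : K.World) : Prop :=
  ∃ (n r : ℕ) (t : Fin n → K.World), K.rel n r t ∧ (∃ i, t i = u) ∧ ∃ j, t j = v

/-- distance at most 1 in the Gaifman graph. -/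
def near (u v : K.World) : Prop := u = v ∨ K.gadj u v

/-- same connected component of the Gaifman graph. -/
def sameComp (u v : K.World) : Prop := Relation.ReflTransGen K.gadj u v

/-- finite degree: every world has finitely many Gaifman-neighbours. -/
def FiniteDegree : Prop := ∀ u, {v | K.gadj u v}.Finite

end Struct

/-- r-atoms `R(x₁,…,xₙ)`: a relation name with its argument variables. -/
structure RAtom where
  name : ℕ
  args : List ℕ

mutual
  /-- Formulas of (U)CPDL⁺ (together with `loop` and program intersection,
  used to carve out the various fragments). -/
  inductive Fml : Type where
    | prop : ℕ → Fml
    | neg : Fml → Fml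
    | and : Fml → Fml → Fml
    | diam : Prog → Fml
    | loop : Prog → Fml
  /-- Programs. -/
  inductive Prog : Type where
    | eps : Prog
    | atom : ℕ → Prog
    | conv : ℕ → Prog
    | union : Prog → Prog → Prog
    | comp : Prog → Prog → Prog
    | star : Prog → Prog
    | test : Fml → Prog
    | inter : Prog → Prog → Prog
    | univ : Prog
    | cq : PList → List RAtom → ℕ → ℕ → Prog
  /-- Finite lists of p-atoms `π(x,y)`. -/
  inductive PList : Type where
    | nil : PList
    | cons : Prog → ℕ → ℕ → PList → PList
end

/-- satisfaction of an r-atom under an assignment. -/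
def Struct.ratomSat (K : Struct) (f : ℕ → K.World) (r : RAtom) : Prop :=
  K.rel r.args.length r.name fun i => f (r.args.get i)

mutual
  /-- semantics of formulas. -/
  def evalF (K : Struct) : Fml → K.World → Prop
    | .prop p, w => K.prop p w
    | .neg φ, w => ¬ evalF K φ w
    | .and φ ψ, w => evalF K φ w ∧ evalF K ψ w
    | .diam π, w => ∃ v, evalP K π w v
    | .loop π, w => evalP K π w w
  /-- semantics of programs. -/
  def evalP (K : Struct) : Prog → K.World → K.World → Prop
    | .eps, u, v => u = v
    | .atom a, u, v => K.prog a u v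
    | .conv a, u, v => K.prog a v u
    | .union π₁ π₂, u, v => evalP K π₁ u v ∨ evalP K π₂ u v
    | .comp π₁ π₂, u, v => ∃ w, evalP K π₁ u w ∧ evalP K π₂ w v
    | .star π, u, v => Relation.ReflTransGen (fun a b => evalP K π a b) u v
    | .test φ, u, v => u = v ∧ evalF K φ u
    | .inter π₁ π₂, u, v => evalP K π₁ u v ∧ evalP K π₂ u v
    | .univ, _, _ => True
    | .cq ps rs xs xt, u, v =>
        ∃ f : ℕ → K.World, f xs = u ∧ f xt = v ∧ evalPL K f ps ∧ ∀ r ∈ rs, K.ratomSat f r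
  /-- semantics of a list of p-atoms. -/
  def evalPL (K : Struct) (f : ℕ → K.World) : PList → Prop
    | .nil => True
    | .cons π x y ps => evalP K π (f x) (f y) ∧ evalPL K f ps
end

/-! ## Conjunctive programs: variables, underlying graph, well-formedness -/

/-- variables occurring in a list of p-atoms. -/
def PList.vars : PList → List ℕ
  | .nil => []
  | .cons _ x y ps => x :: y :: ps.vars

/-- variables of a conjunctive program given by p-atoms `ps` and r-atoms `rs`. -/
def cqVars (ps : PList) (rs : List RAtom) : List ℕ :=
  ps.vars ++ (rs.map RAtom.args).flatten

/-- co-occurrence of two variables in a p-atom of the list. -/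
def PList.coOcc (x y : ℕ) : PList → Prop
  | .nil => False
  | .cons _ a b ps => ((x = a ∨ x = b) ∧ (y = a ∨ y = b)) ∨ PList.coOcc x y ps

/-- adjacency in the graph `G_C`: co-occurrence of two variables in some atom. -/
def atomAdj (ps : PList) (rs : List RAtom) (x y : ℕ) : Prop :=
  ps.coOcc x y ∨ ∃ r ∈ rs, x ∈ r.args ∧ y ∈ r.args

/-- adjacency in the underlying graph of `C[x_s,x_t]`: `G_C` plus the edge `{x_s,x_t}`. -/
def ugAdj (ps : PList) (rs : List RAtom) (xs xt : ℕ) (x y : ℕ) : Prop :=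
  atomAdj ps rs x y ∨ (x = xs ∧ y = xt) ∨ (x = xt ∧ y = xs)

/-- base well-formedness of a conjunctive program `C[x_s,x_t]`:
`x_s,x_t ∈ Vars(C)`, every r-atom has arity `> 2`, and `G_C` is connected. -/
def cqWF (ps : PList) (rs : List RAtom) (xs xt : ℕ) : Prop :=
  xs ∈ cqVars ps rs ∧ xt ∈ cqVars ps rs ∧
  (∀ r ∈ rs, 2 < r.args.length) ∧
  ∀ x ∈ cqVars ps rs, ∀ y ∈ cqVars ps rs, Relation.ReflTransGen (atomAdj ps rs) x y

/-! ## Tree decompositions and tree-width -/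

/-- A tree decomposition of the graph with vertex set `V` and adjacency `adj`. -/
structure TreeDecomp {α : Type} (V : Set α) (adj : α → α → Prop) where
  /-- the nodes of the tree -/
  B : Type
  /-- the tree -/
  tree : SimpleGraph B
  isTree : tree.IsTree
  /-- the bags -/
  bag : B → Set α
  cover_vert : ∀ v ∈ V, ∃ b, v ∈ bag b
  cover_edge : ∀ u v, adj u v → ∃ b, u ∈ bag b ∧ v ∈ bag b
  bags_conn : ∀ (v : α) (b₁ b₂ : B), v ∈ bag b₁ → v ∈ bag b₂ →
      ∃ p : tree.Walk b₁ b₂, ∀ x ∈ p.support, v ∈ bag x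

/-- the width of a tree decomposition is at most `k`. -/
def TreeDecomp.WidthLE {α : Type} {V : Set α} {adj : α → α → Prop}
    (td : TreeDecomp V adj) (k : ℕ) : Prop :=
  ∀ b, (td.bag b).Finite ∧ (td.bag b).ncard ≤ k + 1

/-- the graph `(V, adj)` has tree-width at most `k`. -/
def TreewidthLE {α : Type} (V : Set α) (adj : α → α → Prop) (k : ℕ) : Prop :=
  ∃ td : TreeDecomp V adj, td.WidthLE k

/-- the Gaifman graph of the structure `K` has tree-width at most `k`. -/
def Struct.twLE (K : Struct) (k : ℕ) : Prop :=
  TreewidthLE (Set.univ : Set K.World) K.gadj k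

/-- A good tree decomposition: along every tree edge one bag contains the other,
and the tree is binary (it has a root of degree `≤ 2`, all other nodes have degree `≤ 3`). -/
def TreeDecomp.Good {α : Type} {V : Set α} {adj : α → α → Prop} (td : TreeDecomp V adj) : Prop :=
  (∀ b b', td.tree.Adj b b' → td.bag b ⊆ td.bag b' ∨ td.bag b' ⊆ td.bag b) ∧
  ∃ r : td.B, ∀ b, {b' | td.tree.Adj b b'}.Finite ∧
    ((b = r → {b' | td.tree.Adj b b'}.ncard ≤ 2) ∧ (b ≠ r → {b' | td.tree.Adj b b'}.ncard ≤ 3))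

/-! ## Fragments -/

/-- all p-atoms of the list are of the form `π(x,x)` for the fixed variable `x`. -/
def PList.allOn (x : ℕ) : PList → Prop
  | .nil => True
  | .cons _ a b ps => a = x ∧ b = x ∧ PList.allOn x ps

/-- A fragment specification: which of `loop`, `∩`, `U` are allowed, and which
shapes of conjunctive programs are allowed. -/
structure Frag where
  loopOK : Prop
  interOK : Prop
  univOK : Prop
  cqOK : PList → List RAtom → ℕ → ℕ → Prop

mutual
  /-- the formula belongs to the fragment `F`. -/
  def Fml.In : Frag → Fml → Prop
    | _, .prop _ => True
    | F, .neg φ => Fml.In F φ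
    | F, .and φ ψ => Fml.In F φ ∧ Fml.In F ψ
    | F, .diam π => Prog.In F π
    | F, .loop π => F.loopOK ∧ Prog.In F π
  /-- the program belongs to the fragment `F`. -/
  def Prog.In : Frag → Prog → Prop
    | _, .eps => True
    | _, .atom _ => True
    | _, .conv _ => True
    | F, .union π₁ π₂ => Prog.In F π₁ ∧ Prog.In F π₂
    | F, .comp π₁ π₂ => Prog.In F π₁ ∧ Prog.In F π₂
    | F, .star π => Prog.In F π
    | F, .test φ => Fml.In F φ
    | F, .inter π₁ π₂ => F.interOK ∧ Prog.In F π₁ ∧ Prog.In F π₂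
    | F, .univ => F.univOK
    | F, .cq ps rs xs xt => F.cqOK ps rs xs xt ∧ cqWF ps rs xs xt ∧ PList.In F ps
  /-- all programs of the list belong to the fragment `F`. -/
  def PList.In : Frag → PList → Prop
    | _, .nil => True
    | F, .cons π _ _ ps => Prog.In F π ∧ PList.In F ps
end

/-- CPDL: PDL with converse. -/
def Frag.cpdl : Frag := ⟨False, False, False, fun _ _ _ _ => False⟩
/-- ICPDL: CPDL with program intersection. -/
def Frag.icpdl : Frag := ⟨False, True, False, fun _ _ _ _ => False⟩
/-- loop-CPDL: CPDL with `loop(π)` formulas. -/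
def Frag.loopCpdl : Frag := ⟨True, False, False, fun _ _ _ _ => False⟩
/-- CPDL⁺: CPDL with conjunctive programs. -/
def Frag.cpdlPlus : Frag := ⟨False, False, False, fun _ _ _ _ => True⟩
/-- UCPDL⁺: CPDL⁺ with the universal program. -/
def Frag.ucpdlPlus : Frag := ⟨False, False, True, fun _ _ _ _ => True⟩
/-- CPDL⁺(TW_k): conjunctive programs with underlying graph of tree-width `≤ k`. -/
def Frag.tw (k : ℕ) : Frag :=
  ⟨False, False, False, fun ps rs xs xt =>
    TreewidthLE {x | x ∈ cqVars ps rs} (ugAdj ps rs xs xt) k⟩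
/-- UCPDL⁺(TW_k). -/
def Frag.utw (k : ℕ) : Frag :=
  ⟨False, False, True, fun ps rs xs xt =>
    TreewidthLE {x | x ∈ cqVars ps rs} (ugAdj ps rs xs xt) k⟩
/-- CPDL⁺(𝒢↺): the only conjunctive programs are `C[x,x]` where all atoms
are p-atoms of the form `π(x,x)`. -/
def Frag.gloop : Frag :=
  ⟨False, False, False, fun ps rs xs xt => xt = xs ∧ rs = [] ∧ PList.allOn xs ps⟩
/-- ICPDL⁺(TW₂): CPDL⁺(TW₂) together with program intersection. -/
def Frag.icpdlPlusTw2 : Frag :=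
  ⟨False, True, False, fun ps rs xs xt =>
    TreewidthLE {x | x ∈ cqVars ps rs} (ugAdj ps rs xs xt) 2⟩

mutual
  /-- positive formulas: no occurrence of negation. -/
  def Fml.Positive : Fml → Prop
    | .prop _ => True
    | .neg _ => False
    | .and φ ψ => Fml.Positive φ ∧ Fml.Positive ψ
    | .diam π => Prog.Positive π
    | .loop π => Prog.Positive π
  /-- positive programs. -/
  def Prog.Positive : Prog → Prop
    | .eps => True
    | .atom _ => True
    | .conv _ => True
    | .union π₁ π₂ => Prog.Positive π₁ ∧ Prog.Positive π₂
    | .comp π₁ π₂ => Prog.Positive π₁ ∧ Prog.Positive π₂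
    | .star π => Prog.Positive π
    | .test φ => Fml.Positive φ
    | .inter π₁ π₂ => Prog.Positive π₁ ∧ Prog.Positive π₂
    | .univ => True
    | .cq ps _ _ _ => PList.Positive ps
  /-- positive p-atom lists. -/
  def PList.Positive : PList → Prop
    | .nil => True
    | .cons π _ _ ps => Prog.Positive π ∧ PList.Positive ps
end

/-! ## Sizes, conjunctive width, intersection width -/

/-- sum of the arities of a list of r-atoms. -/
def ratomSize (rs : List RAtom) : ℕ := (rs.map fun r => r.args.length).sum

mutual
  /-- size of a formula. -/
  def Fml.fsize : Fml → ℕ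
    | .prop _ => 1
    | .neg φ => 1 + Fml.fsize φ
    | .and φ ψ => Fml.fsize φ + Fml.fsize ψ
    | .diam π => 1 + Prog.psize π
    | .loop π => 1 + Prog.psize π
  /-- size of a program. -/
  def Prog.psize : Prog → ℕ
    | .eps => 1
    | .atom _ => 1
    | .conv _ => 1
    | .union π₁ π₂ => Prog.psize π₁ + Prog.psize π₂
    | .comp π₁ π₂ => Prog.psize π₁ + Prog.psize π₂
    | .star π => 1 + Prog.psize π
    | .test φ => 1 + Fml.fsize φ
    | .inter π₁ π₂ => Prog.psize π₁ + Prog.psize π₂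
    | .univ => 1
    | .cq ps rs _ _ => ratomSize rs + PList.plsize ps
  /-- size of a p-atom list: `Σ (1 + |π|)`. -/
  def PList.plsize : PList → ℕ
    | .nil => 0
    | .cons π _ _ ps => 1 + Prog.psize π + PList.plsize ps
end

mutual
  /-- conjunctive width of a program. -/
  def Prog.cw : Prog → ℕ
    | .eps => 1
    | .atom _ => 1
    | .conv _ => 1
    | .union π₁ π₂ => max (Prog.cw π₁) (Prog.cw π₂)
    | .comp π₁ π₂ => max (Prog.cw π₁) (Prog.cw π₂)
    | .star π => Prog.cw π
    | .test _ => 1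
    | .inter π₁ π₂ => Prog.cw π₁ + Prog.cw π₂
    | .univ => 1
    | .cq ps rs _ _ => ratomSize rs + PList.cwSum ps
  /-- sum of the conjunctive widths of the programs of a p-atom list. -/
  def PList.cwSum : PList → ℕ
    | .nil => 0
    | .cons π _ _ ps => Prog.cw π + PList.cwSum ps
end

mutual
  /-- conjunctive width of a formula: max of `Prog.cw` over all programs therein. -/
  def Fml.cwE : Fml → ℕ
    | .prop _ => 1
    | .neg φ => Fml.cwE φ
    | .and φ ψ => max (Fml.cwE φ) (Fml.cwE ψ)
    | .diam π => Prog.cwE π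
    | .loop π => Prog.cwE π
  /-- conjunctive width of an expression which is a program. -/
  def Prog.cwE : Prog → ℕ
    | .eps => 1
    | .atom _ => 1
    | .conv _ => 1
    | .union π₁ π₂ => max (Prog.cwE π₁) (Prog.cwE π₂)
    | .comp π₁ π₂ => max (Prog.cwE π₁) (Prog.cwE π₂)
    | .star π => Prog.cwE π
    | .test φ => Fml.cwE φ
    | .inter π₁ π₂ => max (Prog.cw (.inter π₁ π₂)) (max (Prog.cwE π₁) (Prog.cwE π₂))
    | .univ => 1
    | .cq ps rs xs xt => max (Prog.cw (.cq ps rs xs xt)) (PList.cwEMax ps)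
  /-- max conjunctive width over a p-atom list. -/
  def PList.cwEMax : PList → ℕ
    | .nil => 1
    | .cons π _ _ ps => max (Prog.cwE π) (PList.cwEMax ps)
end

mutual
  /-- intersection width of an (I)CPDL program. -/
  def Prog.iw : Prog → ℕ
    | .eps => 1
    | .atom _ => 1
    | .conv _ => 1
    | .union π₁ π₂ => max (Prog.iw π₁) (Prog.iw π₂)
    | .comp π₁ π₂ => max (Prog.iw π₁) (Prog.iw π₂)
    | .star π => Prog.iw π
    | .test _ => 1
    | .inter π₁ π₂ => Prog.iw π₁ + Prog.iw π₂
    | .univ => 1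
    | .cq _ _ _ _ => 1
  /-- max intersection width over a p-atom list (unused on ICPDL). -/
  def PList.iwMax : PList → ℕ
    | .nil => 1
    | .cons π _ _ ps => max (Prog.iwE π) (PList.iwMax ps)
  /-- intersection width of an expression which is a program. -/
  def Prog.iwE : Prog → ℕ
    | .eps => 1
    | .atom _ => 1
    | .conv _ => 1
    | .union π₁ π₂ => max (Prog.iwE π₁) (Prog.iwE π₂)
    | .comp π₁ π₂ => max (Prog.iwE π₁) (Prog.iwE π₂)
    | .star π => Prog.iwE π
    | .test φ => Fml.iwE φ
    | .inter π₁ π₂ => max (Prog.iw (.inter π₁ π₂)) (max (Prog.iwE π₁) (Prog.iwE π₂))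
    | .univ => 1
    | .cq ps _ _ _ => PList.iwMax ps
  /-- intersection width of a formula. -/
  def Fml.iwE : Fml → ℕ
    | .prop _ => 1
    | .neg φ => Fml.iwE φ
    | .and φ ψ => max (Fml.iwE φ) (Fml.iwE ψ)
    | .diam π => Prog.iwE π
    | .loop π => Prog.iwE π
end

/-! ## Translations between fragments -/

/-- `Translatable F₁ F₂` (over Kripke structures): there are translations mapping
`F₁`-formulas to `F₂`-formulas and `F₁`-programs to `F₂`-programs preserving the
semantics on every Kripke structure; moreover the translations are polynomial-time
computable (witnessed here by a polynomial bound on the size of the output). -/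
def Translatable (F₁ F₂ : Frag) : Prop :=
  ∃ (tf : Fml → Fml) (tp : Prog → Prog),
    (∀ φ, Fml.In F₁ φ → Fml.In F₂ (tf φ) ∧
      ∀ K : Struct, K.IsKripke → ∀ w, evalF K φ w ↔ evalF K (tf φ) w) ∧
    (∀ π, Prog.In F₁ π → Prog.In F₂ (tp π) ∧
      ∀ K : Struct, K.IsKripke → ∀ u v, evalP K π u v ↔ evalP K (tp π) u v) ∧
    ∃ c : ℕ, (∀ φ, Fml.In F₁ φ → Fml.fsize (tf φ) ≤ c * (Fml.fsize φ + 1) ^ c) ∧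
      ∀ π, Prog.In F₁ π → Prog.psize (tp π) ≤ c * (Prog.psize π + 1) ^ c

/-- `TranslatableAll F₁ F₂`: semantics-preserving translations over all structures
(no effectivity requirement). -/
def TranslatableAll (F₁ F₂ : Frag) : Prop :=
  ∃ (tf : Fml → Fml) (tp : Prog → Prog),
    (∀ φ, Fml.In F₁ φ → Fml.In F₂ (tf φ) ∧
      ∀ (K : Struct) (w : K.World), evalF K φ w ↔ evalF K (tf φ) w) ∧
    ∀ π, Prog.In F₁ π → Prog.In F₂ (tp π) ∧
      ∀ (K : Struct) (u v : K.World), evalP K π u v ↔ evalP K (tp π) u v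

/-! ## Trees and elimination orders -/

section Trees

variable {B : Type} {T : SimpleGraph B}

/-- In a tree rooted at `r`, of two adjacent nodes one is the parent of the other. -/
theorem exists_parent (hT : T.IsTree) (r : B) :
    ∃ par : B → B, ∀ b b', T.Adj b b' →
      (par b = b' ∧ T.dist r b = T.dist r b' + 1) ∨
      (par b' = b ∧ T.dist r b' = T.dist r b + 1) := by
  classical
  have uniq : ∀ b w₁ w₂, T.Adj b w₁ → T.Adj b w₂ → T.dist r b = T.dist r w₁ + 1 →
      T.dist r b = T.dist r w₂ + 1 → w₁ = w₂ := by
    intro b w₁ w₂ h₁ h₂ d₁ d₂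
    obtain ⟨p₁, hp₁⟩ := hT.connected.exists_walk_length_eq_dist r w₁
    obtain ⟨p₂, hp₂⟩ := hT.connected.exists_walk_length_eq_dist r w₂
    have q₁ : (p₁.concat h₁.symm).IsPath :=
      SimpleGraph.Walk.isPath_of_length_eq_dist _ (by simp [hp₁, d₁])
    have q₂ : (p₂.concat h₂.symm).IsPath :=
      SimpleGraph.Walk.isPath_of_length_eq_dist _ (by simp [hp₂, d₂])
    have h := (hT.isAcyclic.subsingleton_path r b).elim ⟨_, q₁⟩ ⟨_, q₂⟩
    have h' := congrArg (fun p : T.Path r b => p.1.penultimate) h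
    simpa using h'
  refine ⟨fun b => if h : ∃ w, T.Adj b w ∧ T.dist r b = T.dist r w + 1 then h.choose else b, ?_⟩
  have key : ∀ b b', T.Adj b b' → T.dist r b = T.dist r b' + 1 →
      (if h : ∃ w, T.Adj b w ∧ T.dist r b = T.dist r w + 1 then h.choose else b) = b' := by
    intro b b' hb hd
    have h : ∃ w, T.Adj b w ∧ T.dist r b = T.dist r w + 1 := ⟨b', hb, hd⟩
    rw [dif_pos h]
    exact uniq b _ _ h.choose_spec.1 hb h.choose_spec.2 hd
  intro b b' hb
  rcases hT.dist_eq_dist_add_one_of_adj r hb with h | h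
  · exact Or.inl ⟨key b b' hb h, h⟩
  · exact Or.inr ⟨key b' b hb.symm h, h⟩

variable {par : B → B} {δ : B → ℕ}

theorem ancestor_eq_of_walk
    (hpar : ∀ b b', T.Adj b b' → (par b = b' ∧ δ b = δ b' + 1) ∨ (par b' = b ∧ δ b' = δ b + 1))
    (m : ℕ) {x y : B} (w : T.Walk x y) (hw : ∀ z ∈ w.support, m ≤ δ z) :
    par^[δ x - m] x = par^[δ y - m] y := by
  induction w with
  | nil => rfl
  | @cons x x' y h w ih =>
    have hx : m ≤ δ x := hw x (by simp)
    have hx' : m ≤ δ x' := hw x' (by simp)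
    rw [← ih fun z hz => hw z (by simp [hz])]
    rcases hpar x x' h with ⟨h₁, h₂⟩ | ⟨h₁, h₂⟩
    · rw [h₂, Nat.succ_sub hx', Function.iterate_succ_apply, h₁]
    · rw [h₂, Nat.succ_sub hx, Function.iterate_succ_apply, h₁]

theorem ancestor_mem_support
    (hpar : ∀ b b', T.Adj b b' → (par b = b' ∧ δ b = δ b' + 1) ∨ (par b' = b ∧ δ b' = δ b + 1))
    (m : ℕ) {x y : B} (w : T.Walk x y) (hx : m ≤ δ x) (hy : δ y ≤ m) :
    par^[δ x - m] x ∈ w.support := by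
  induction w with
  | @nil x => simp [Nat.sub_eq_zero_of_le hy]
  | @cons x x' y h w ih =>
    rcases hx.eq_or_lt with hm | hm
    · simp [hm]
    · have hx' : m ≤ δ x' := by rcases hpar x x' h with h | h <;> omega
      have := ih hx' hy
      rw [SimpleGraph.Walk.support_cons, List.mem_cons]
      right
      rcases hpar x x' h with ⟨h₁, h₂⟩ | ⟨h₁, h₂⟩
      · rwa [h₂, Nat.succ_sub hx', Function.iterate_succ_apply, h₁]
      · rwa [h₂, Nat.succ_sub hx, Function.iterate_succ_apply, h₁] at this

end Trees

/-- `S` is a chordal supergraph of cliques of size at most three, with `d` giving (in decreasing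
order) a perfect elimination order. -/
structure Elim {α : Type} (S : α → α → Prop) (d : α → ℕ) : Prop where
  symm : ∀ x y, S x y → S y x
  clique : ∀ z a b, S z a → S z b → d a ≤ d z → d b ≤ d z → S a b
  card : ∀ z a b c, S z a → S z b → S z c → d a ≤ d z → d b ≤ d z → d c ≤ d z →
    z ≠ a → z ≠ b → z ≠ c → a ≠ b → a ≠ c → b ≠ c → False

theorem exists_elim {α : Type} {V : Set α} {adj : α → α → Prop} (h : TreewidthLE V adj 2)
    {s t : α} (hst : adj s t) :
    ∃ (S : α → α → Prop) (d : α → ℕ), Elim S d ∧ (∀ x y, adj x y → S x y) ∧ d s = 0 ∧ d t = 0 := by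
  classical
  obtain ⟨td, hw⟩ := h
  obtain ⟨r, hs, ht⟩ := td.cover_edge s t hst
  obtain ⟨par, hpar⟩ := exists_parent td.isTree r
  set δ : td.B → ℕ := td.tree.dist r with hδ
  set S : α → α → Prop := fun x y => ∃ b, x ∈ td.bag b ∧ y ∈ td.bag b with hS
  set d : α → ℕ := fun v => sInf {n | ∃ b, v ∈ td.bag b ∧ δ b = n} with hd
  have dle : ∀ v b, v ∈ td.bag b → d v ≤ δ b := fun v b hb => Nat.sInf_le ⟨b, hb, rfl⟩
  have dtop : ∀ v b, v ∈ td.bag b → ∃ c, v ∈ td.bag c ∧ δ c = d v := fun v b hb =>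
    Nat.sInf_mem (s := {n | ∃ b, v ∈ td.bag b ∧ δ b = n}) ⟨_, b, hb, rfl⟩
  have key : ∀ z, ∃ c, ∀ a, S z a → d a ≤ d z → z ∈ td.bag c ∧ a ∈ td.bag c := by
    intro z
    by_cases hz : ∃ b, z ∈ td.bag b
    · obtain ⟨b₀, hb₀⟩ := hz
      obtain ⟨c, hc, hcd⟩ := dtop z b₀ hb₀
      refine ⟨c, fun a ⟨b, hzb, hab⟩ hda => ⟨hc, ?_⟩⟩
      obtain ⟨e, he, hed⟩ := dtop a b hab
      obtain ⟨p, hp⟩ := td.bags_conn z b c hzb hc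
      obtain ⟨q, hq⟩ := td.bags_conn a b e hab he
      have h₁ := ancestor_eq_of_walk hpar (d z) p fun x hx => dle z x (hp x hx)
      have h₂ := ancestor_mem_support hpar (d z) q (dle z b hzb) (hed.trans_le hda)
      rw [h₁, hcd, Nat.sub_self] at h₂
      exact hq _ h₂
    · refine ⟨r, fun a ⟨b, hb, _⟩ => absurd ⟨b, hb⟩ hz⟩
  have droot : ∀ v, v ∈ td.bag r → d v = 0 := fun v hv => by
    have := dle v r hv
    simpa [hδ] using this
  refine ⟨S, d, ⟨fun x y ⟨b, hx, hy⟩ => ⟨b, hy, hx⟩, ?_, ?_⟩, td.cover_edge, droot s hs, droot t ht⟩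
  · intro z a b ha hb hda hdb
    obtain ⟨c, hc⟩ := key z
    exact ⟨c, (hc a ha hda).2, (hc b hb hdb).2⟩
  · intro z a b c ha hb hc hda hdb hdc hza hzb hzc hab hac hbc
    obtain ⟨e, he⟩ := key z
    obtain ⟨hfin, hcard⟩ := hw e
    have hsub : (({z, a, b, c} : Finset α) : Set α) ⊆ td.bag e := by
      intro x hx
      simp only [Finset.coe_insert, Finset.coe_singleton, Set.mem_insert_iff,
        Set.mem_singleton_iff] at hx
      rcases hx with rfl | rfl | rfl | rfl
      · exact (he _ ha hda).1
      · exact (he _ ha hda).2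
      · exact (he _ hb hdb).2
      · exact (he _ hc hdc).2
    have h := Set.ncard_le_ncard hsub hfin
    rw [Set.ncard_coe_finset] at h
    have h4 : ({z, a, b, c} : Finset α).card = 4 := by
      simp [hza, hzb, hzc, hab, hac, hbc]
    omega

/-! ## Converse of ICPDL programs -/

/-- The converse of a program without conjunctive subprograms. -/
def Prog.rev : Prog → Prog
  | .eps => .eps
  | .atom a => .conv a
  | .conv a => .atom a
  | .union π₁ π₂ => .union π₁.rev π₂.rev
  | .comp π₁ π₂ => .comp π₂.rev π₁.rev
  | .star π => .star π.rev
  | .test φ => .test φ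
  | .inter π₁ π₂ => .inter π₁.rev π₂.rev
  | .univ => .univ
  | .cq ps rs xs xt => .cq ps rs xt xs

theorem Prog.rev_spec : ∀ π : Prog, Prog.In Frag.icpdl π →
    Prog.In Frag.icpdl π.rev ∧ π.rev.psize = π.psize ∧
      ∀ (K : Struct) (u v : K.World), evalP K π.rev u v ↔ evalP K π v u
  | .eps, _ => ⟨trivial, rfl, fun _ _ _ => by simp [Prog.rev, evalP, eq_comm]⟩
  | .atom a, _ => ⟨trivial, rfl, fun _ _ _ => Iff.rfl⟩
  | .conv a, _ => ⟨trivial, rfl, fun _ _ _ => Iff.rfl⟩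
  | .union π₁ π₂, h => by
    simp only [Prog.In] at h
    obtain ⟨a₁, b₁, c₁⟩ := π₁.rev_spec h.1
    obtain ⟨a₂, b₂, c₂⟩ := π₂.rev_spec h.2
    exact ⟨by simp [Prog.rev, Prog.In, a₁, a₂], by simp [Prog.rev, Prog.psize, b₁, b₂],
      fun K u v => by simp [Prog.rev, evalP, c₁, c₂]⟩
  | .comp π₁ π₂, h => by
    simp only [Prog.In] at h
    obtain ⟨a₁, b₁, c₁⟩ := π₁.rev_spec h.1
    obtain ⟨a₂, b₂, c₂⟩ := π₂.rev_spec h.2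
    exact ⟨by simp [Prog.rev, Prog.In, a₁, a₂], by simp [Prog.rev, Prog.psize, b₁, b₂, add_comm],
      fun K u v => by simp [Prog.rev, evalP, c₁, c₂, and_comm]⟩
  | .star π, h => by
    simp only [Prog.In] at h
    obtain ⟨a, b, c⟩ := π.rev_spec h
    refine ⟨by simp [Prog.rev, Prog.In, a], by simp [Prog.rev, Prog.psize, b], fun K u v => ?_⟩
    simp only [Prog.rev, evalP, c]
    exact Relation.reflTransGen_swap
  | .test φ, h => ⟨h, rfl, fun K u v => by
    simp only [Prog.rev, evalP]
    constructor <;> (rintro ⟨rfl, h⟩; exact ⟨rfl, h⟩)⟩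
  | .inter π₁ π₂, h => by
    simp only [Prog.In] at h
    obtain ⟨a₁, b₁, c₁⟩ := π₁.rev_spec h.2.1
    obtain ⟨a₂, b₂, c₂⟩ := π₂.rev_spec h.2.2
    exact ⟨by simp [Prog.rev, Prog.In, a₁, a₂, h.1], by simp [Prog.rev, Prog.psize, b₁, b₂],
      fun K u v => by simp [Prog.rev, evalP, c₁, c₂]⟩
  | .univ, h => by simp [Prog.In, Frag.icpdl] at h
  | .cq .., h => by simp [Prog.In, Frag.icpdl] at h

/-! ## Elimination of variables -/

/-- A p-atom `π(x,y)`. -/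
structure PAtom where
  prog : Prog
  src : ℕ
  tgt : ℕ

/-- The flipped p-atom. -/
def PAtom.flip (e : PAtom) : PAtom := ⟨e.prog.rev, e.tgt, e.src⟩

/-- Satisfaction of a list of p-atoms. -/
def SatL (K : Struct) (f : ℕ → K.World) (L : List PAtom) : Prop :=
  ∀ e ∈ L, evalP K e.prog (f e.src) (f e.tgt)

/-- `1` for edges and `0` for loops. -/
def PAtom.edge (e : PAtom) : ℕ := if e.src = e.tgt then 0 else 1

/-- The number of reduction steps an atom can take part in. -/
def measureL (L : List PAtom) : ℕ := (L.map fun e => 1 + e.edge).sum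

/-- Bound for the size of the program obtained by eliminating variables. -/
def weightL (L : List PAtom) : ℕ := (L.map fun e => e.prog.psize + 2 * (1 + e.edge)).sum

/-- All programs of the list are ICPDL programs. -/
def InL (L : List PAtom) : Prop := ∀ e ∈ L, Prog.In Frag.icpdl e.prog

/-- All atoms of the list satisfy the relation `Q`. -/
def AllRel (Q : ℕ → ℕ → Prop) (L : List PAtom) : Prop := ∀ e ∈ L, Q e.src e.tgt

/-- Two lists of ICPDL atoms that agree up to reordering and flipping of atoms. -/
structure Similar (L L' : List PAtom) : Prop where
  sat : ∀ (K : Struct) (f : ℕ → K.World), SatL K f L ↔ SatL K f L'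
  measure : measureL L = measureL L'
  weight : weightL L = weightL L'
  inL : InL L'
  rel : ∀ Q : ℕ → ℕ → Prop, (∀ x y, Q x y → Q y x) → (AllRel Q L ↔ AllRel Q L')

theorem Similar.trans {L₁ L₂ L₃ : List PAtom} (h : Similar L₁ L₂) (h' : Similar L₂ L₃) :
    Similar L₁ L₃ where
  sat K f := (h.sat K f).trans (h'.sat K f)
  measure := h.measure.trans h'.measure
  weight := h.weight.trans h'.weight
  inL := h'.inL
  rel Q hQ := (h.rel Q hQ).trans (h'.rel Q hQ)

theorem Similar.of_perm {L L' : List PAtom} (hL : InL L) (h : L.Perm L') : Similar L L' where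
  sat K f := by simp only [SatL, h.mem_iff]
  measure := (h.map _).sum_eq
  weight := (h.map _).sum_eq
  inL := fun e he => hL e (h.mem_iff.2 he)
  rel Q _ := by simp only [AllRel, h.mem_iff]

theorem Similar.cons {L L' : List PAtom} (h : Similar L L') {e : PAtom}
    (he : Prog.In Frag.icpdl e.prog) : Similar (e :: L) (e :: L') where
  sat K f := by
    have := h.sat K f
    simp only [SatL, List.forall_mem_cons] at this ⊢
    rw [this]
  measure := by
    have := h.measure
    simp only [measureL, List.map_cons, List.sum_cons] at this ⊢
    rw [this]
  weight := by
    have := h.weight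
    simp only [weightL, List.map_cons, List.sum_cons] at this ⊢
    rw [this]
  inL := List.forall_mem_cons.2 ⟨he, h.inL⟩
  rel Q hQ := by
    have := h.rel Q hQ
    simp only [AllRel, List.forall_mem_cons] at this ⊢
    rw [this]

theorem Similar.flip {e : PAtom} {L : List PAtom} (hL : InL (e :: L)) :
    Similar (e :: L) (e.flip :: L) := by
  obtain ⟨h₁, h₂, h₃⟩ := e.prog.rev_spec (hL e (by simp))
  have hedge : e.flip.edge = e.edge := by simp [PAtom.edge, PAtom.flip, eq_comm]
  refine ⟨fun K f => ?_, ?_, ?_, ?_, fun Q hQ => ?_⟩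
  · simp [SatL, PAtom.flip, h₃]
  · simp [measureL, hedge]
  · simp only [weightL, List.map_cons, List.sum_cons, hedge]
    simp [PAtom.flip, h₂]
  · exact List.forall_mem_cons.2 ⟨h₁, (List.forall_mem_cons.1 hL).2⟩
  · simp only [AllRel, List.forall_mem_cons, PAtom.flip]
    rw [show Q e.src e.tgt ↔ Q e.tgt e.src from ⟨hQ _ _, hQ _ _⟩]

/-- An atom using the variable `z` can be moved to the front, with `z` as its source. -/
theorem exists_similar_cons {L : List PAtom} (hL : InL L) {z : ℕ} {Q : ℕ → ℕ → Prop}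
    (hQ : ∀ x y, Q x y → Q y x) (hz : ¬ AllRel Q L) (hQz : ∀ x y, z ≠ x → z ≠ y → Q x y) :
    ∃ ρ a L', Similar L (⟨ρ, z, a⟩ :: L') ∧ ¬ Q z a := by
  simp only [AllRel, not_forall] at hz
  obtain ⟨e, he, hne⟩ := hz
  obtain ⟨l₁, l₂, rfl⟩ := List.append_of_mem he
  have h₁ := Similar.of_perm hL (List.perm_middle (l₁ := l₁) (l₂ := l₂) (a := e))
  by_cases hs : z = e.src
  · subst hs
    exact ⟨e.prog, e.tgt, _, h₁, hne⟩
  · have ht : z = e.tgt := by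
      by_contra ht
      exact hne (hQz _ _ hs ht)
    subst ht
    exact ⟨_, e.src, _, h₁.trans (Similar.flip h₁.inL), fun h => hne (hQ _ _ h)⟩

/-- The atoms of `L` connect all their variables and `s` and `t`. -/
def Conn (L : List PAtom) (s t : ℕ) : Prop :=
  ∀ X : ℕ → Prop, AllRel (fun x y => X x ↔ X y) L →
    (X s ↔ X t) ∧ AllRel (fun x y => (X s ↔ X x) ∧ (X s ↔ X y)) L

/-- The conjunctive program with atoms `L` and endpoints `s`, `t` is expressible in ICPDL. -/
def Expressible (L : List PAtom) (s t : ℕ) : Prop :=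
  ∃ π, Prog.In Frag.icpdl π ∧ π.psize ≤ weightL L + 1 ∧
    ∀ (K : Struct) (u v : K.World), evalP K π u v ↔ ∃ f : ℕ → K.World, f s = u ∧ f t = v ∧ SatL K f L

/-- Hypotheses under which variables can be eliminated. -/
structure Admissible (S : ℕ → ℕ → Prop) (L : List PAtom) (s t : ℕ) : Prop where
  inL : InL L
  conn : Conn L s t
  rel : AllRel S L

theorem Similar.conn {L L' : List PAtom} (h : Similar L L') {s t : ℕ} (hc : Conn L s t) :
    Conn L' s t := by
  intro X hX
  obtain ⟨h₁, h₂⟩ := hc X ((h.rel _ fun _ _ h => h.symm).2 hX)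
  exact ⟨h₁, (h.rel _ fun _ _ h => h.symm).1 h₂⟩

theorem Similar.admissible {S : ℕ → ℕ → Prop} {L L' : List PAtom} (h : Similar L L')
    (hS : ∀ x y, S x y → S y x) {s t : ℕ} (hL : Admissible S L s t) : Admissible S L' s t :=
  ⟨h.inL, h.conn hL.conn, (h.rel S hS).1 hL.rel⟩

theorem Similar.expressible {L L' : List PAtom} (h : Similar L L') {s t : ℕ}
    (he : Expressible L' s t) : Expressible L s t := by
  obtain ⟨π, h₁, h₂, h₃⟩ := he
  exact ⟨π, h₁, h.weight ▸ h₂, fun K u v => by simp only [h₃, h.sat K]⟩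

theorem Expressible.of_reduction {L L' : List PAtom} {s t : ℕ} (he : Expressible L' s t)
    (hw : weightL L' ≤ weightL L)
    (hsat : ∀ (K : Struct) (u v : K.World), (∃ f : ℕ → K.World, f s = u ∧ f t = v ∧ SatL K f L) ↔
      ∃ f : ℕ → K.World, f s = u ∧ f t = v ∧ SatL K f L') : Expressible L s t := by
  obtain ⟨π, h₁, h₂, h₃⟩ := he
  exact ⟨π, h₁, h₂.trans (by omega), fun K u v => by rw [h₃, hsat]⟩

section Steps

variable {S : ℕ → ℕ → Prop} {s t : ℕ} {L : List PAtom} {n : ℕ}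

theorem expressible_merge
    (ih : ∀ L', measureL L' < n → Admissible S L' s t → Expressible L' s t)
    {ρ τ : Prog} {x y : ℕ} (hn : measureL (⟨ρ, x, y⟩ :: ⟨τ, x, y⟩ :: L) ≤ n)
    (hL : Admissible S (⟨ρ, x, y⟩ :: ⟨τ, x, y⟩ :: L) s t) :
    Expressible (⟨ρ, x, y⟩ :: ⟨τ, x, y⟩ :: L) s t := by
  obtain ⟨hin, hconn, hrel⟩ := hL
  simp only [InL, AllRel, List.forall_mem_cons] at hin hrel
  have he : Expressible (⟨.inter ρ τ, x, y⟩ :: L) s t := by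
    refine ih _ ?_ ⟨?_, ?_, ?_⟩
    · simp only [measureL, List.map_cons, List.sum_cons, PAtom.edge] at hn ⊢
      omega
    · simp only [InL, List.forall_mem_cons, Prog.In]
      exact ⟨⟨trivial, hin.1, hin.2.1⟩, hin.2.2⟩
    · intro X hX
      have := hconn X
      simp only [AllRel, List.forall_mem_cons] at hX this ⊢
      tauto
    · simp only [AllRel, List.forall_mem_cons]
      tauto
  refine he.of_reduction ?_ fun K u v => ?_
  · simp only [weightL, List.map_cons, List.sum_cons, PAtom.edge, Prog.psize]
    omega
  · simp only [SatL, List.forall_mem_cons, evalP, and_assoc]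

theorem expressible_absorb_loop
    (ih : ∀ L', measureL L' < n → Admissible S L' s t → Expressible L' s t)
    {ρ τ : Prog} {x y : ℕ} (hn : measureL (⟨τ, x, x⟩ :: ⟨ρ, x, y⟩ :: L) ≤ n)
    (hL : Admissible S (⟨τ, x, x⟩ :: ⟨ρ, x, y⟩ :: L) s t) :
    Expressible (⟨τ, x, x⟩ :: ⟨ρ, x, y⟩ :: L) s t := by
  obtain ⟨hin, hconn, hrel⟩ := hL
  simp only [InL, AllRel, List.forall_mem_cons] at hin hrel
  have he : Expressible (⟨.comp (.inter τ .eps) ρ, x, y⟩ :: L) s t := by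
    refine ih _ ?_ ⟨?_, ?_, ?_⟩
    · simp only [measureL, List.map_cons, List.sum_cons, PAtom.edge] at hn ⊢
      omega
    · simp only [InL, List.forall_mem_cons, Prog.In]
      exact ⟨⟨⟨trivial, hin.1, trivial⟩, hin.2.1⟩, hin.2.2⟩
    · intro X hX
      have := hconn X
      simp only [AllRel, List.forall_mem_cons] at hX this ⊢
      tauto
    · simp only [AllRel, List.forall_mem_cons]
      tauto
  refine he.of_reduction ?_ fun K u v => ?_
  · simp only [weightL, List.map_cons, List.sum_cons, PAtom.edge, Prog.psize]
    omega
  · simp only [SatL, List.forall_mem_cons, evalP]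
    refine exists_congr fun f => and_congr_right fun _ => and_congr_right fun _ => ?_
    constructor
    · rintro ⟨h₁, h₂, h₃⟩
      exact ⟨⟨f x, ⟨h₁, rfl⟩, h₂⟩, h₃⟩
    · rintro ⟨⟨w, ⟨h₁, rfl⟩, h₂⟩, h₃⟩
      exact ⟨h₁, h₂, h₃⟩

/-- The variable `z` does not occur in `L`. -/
abbrev Fresh (z : ℕ) (L : List PAtom) : Prop := AllRel (fun x y => z ≠ x ∧ z ≠ y) L

theorem satL_update {K : Struct} {f : ℕ → K.World} {z : ℕ} (w : K.World) (hz : Fresh z L) :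
    SatL K (Function.update f z w) L ↔ SatL K f L := by
  refine forall₂_congr fun e he => ?_
  rw [Function.update_of_ne (hz e he).1.symm, Function.update_of_ne (hz e he).2.symm]

theorem allRel_update {X : ℕ → Prop} {z : ℕ} (w : Prop) (hz : Fresh z L)
    {R : Prop → Prop → Prop} :
    AllRel (fun x y => R (Function.update X z w x) (Function.update X z w y)) L ↔
      AllRel (fun x y => R (X x) (X y)) L := by
  refine forall₂_congr fun e he => ?_
  simp only [Function.update_of_ne (hz e he).1.symm, Function.update_of_ne (hz e he).2.symm]

theorem expressible_leaf
    (ih : ∀ L', measureL L' < n → Admissible S L' s t → Expressible L' s t)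
    {ρ : Prog} {z a : ℕ} (hn : measureL (⟨ρ, z, a⟩ :: L) ≤ n)
    (hL : Admissible S (⟨ρ, z, a⟩ :: L) s t) (hza : z ≠ a) (hzs : z ≠ s) (hzt : z ≠ t)
    (hz : Fresh z L) (hS : S a a) :
    Expressible (⟨ρ, z, a⟩ :: L) s t := by
  obtain ⟨hin, hconn, hrel⟩ := hL
  simp only [InL, AllRel, List.forall_mem_cons] at hin hrel
  obtain ⟨hr₁, hr₂, hr₃⟩ := ρ.rev_spec hin.1
  have he : Expressible (⟨.test (.diam ρ.rev), a, a⟩ :: L) s t := by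
    refine ih _ ?_ ⟨?_, ?_, ?_⟩
    · simp only [measureL, List.map_cons, List.sum_cons, PAtom.edge, if_neg hza] at hn ⊢
      simp only [if_true]
      omega
    · simp only [InL, List.forall_mem_cons, Prog.In, Fml.In]
      exact ⟨hr₁, hin.2⟩
    · intro X hX
      have := hconn (Function.update X z (X a))
      have e₁ := allRel_update (X := X) (X a) hz (R := fun p q => p ↔ q)
      have e₂ := allRel_update (X := X) (X a) hz (R := fun p q => (X s ↔ p) ∧ (X s ↔ q))
      simp only [AllRel, List.forall_mem_cons, Function.update_self,
        Function.update_of_ne hza.symm, Function.update_of_ne hzs.symm,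
        Function.update_of_ne hzt.symm] at hX this e₁ e₂ ⊢
      tauto
    · simp only [AllRel, List.forall_mem_cons]
      tauto
  refine he.of_reduction ?_ fun K u v => ?_
  · simp only [weightL, List.map_cons, List.sum_cons, PAtom.edge, Prog.psize, Fml.fsize,
      if_neg hza, hr₂]
    simp only [if_true]
    omega
  · have hu := @satL_update L K
    simp only [SatL, List.forall_mem_cons, evalP, evalF, hr₃] at hu ⊢
    constructor
    · rintro ⟨f, h₁, h₂, h₃, h₄⟩
      exact ⟨f, h₁, h₂, ⟨trivial, f z, h₃⟩, h₄⟩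
    · rintro ⟨f, h₁, h₂, ⟨_, w, h₃⟩, h₄⟩
      refine ⟨Function.update f z w, ?_, ?_, ?_, (hu w hz).2 h₄⟩
      · rwa [Function.update_of_ne hzs.symm]
      · rwa [Function.update_of_ne hzt.symm]
      · rwa [Function.update_self, Function.update_of_ne hza.symm]

theorem expressible_path
    (ih : ∀ L', measureL L' < n → Admissible S L' s t → Expressible L' s t)
    {ρ τ : Prog} {z a b : ℕ} (hn : measureL (⟨ρ, z, a⟩ :: ⟨τ, z, b⟩ :: L) ≤ n)
    (hL : Admissible S (⟨ρ, z, a⟩ :: ⟨τ, z, b⟩ :: L) s t) (hza : z ≠ a) (hzb : z ≠ b)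
    (hzs : z ≠ s) (hzt : z ≠ t) (hz : Fresh z L) (hS : S a b) :
    Expressible (⟨ρ, z, a⟩ :: ⟨τ, z, b⟩ :: L) s t := by
  obtain ⟨hin, hconn, hrel⟩ := hL
  simp only [InL, AllRel, List.forall_mem_cons] at hin hrel
  obtain ⟨hr₁, hr₂, hr₃⟩ := ρ.rev_spec hin.1
  have hle : (PAtom.mk (.comp ρ.rev τ) a b).edge ≤ 1 := by
    unfold PAtom.edge
    split <;> omega
  have he : Expressible (⟨.comp ρ.rev τ, a, b⟩ :: L) s t := by
    refine ih _ ?_ ⟨?_, ?_, ?_⟩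
    · simp only [measureL, List.map_cons, List.sum_cons, PAtom.edge, if_neg hza, if_neg hzb]
        at hn hle ⊢
      omega
    · simp only [InL, List.forall_mem_cons, Prog.In]
      exact ⟨⟨hr₁, hin.2.1⟩, hin.2.2⟩
    · intro X hX
      have := hconn (Function.update X z (X a))
      have e₁ := allRel_update (X := X) (X a) hz (R := fun p q => p ↔ q)
      have e₂ := allRel_update (X := X) (X a) hz (R := fun p q => (X s ↔ p) ∧ (X s ↔ q))
      simp only [AllRel, List.forall_mem_cons, Function.update_self,
        Function.update_of_ne hza.symm, Function.update_of_ne hzs.symm,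
        Function.update_of_ne hzb.symm, Function.update_of_ne hzt.symm] at hX this e₁ e₂ ⊢
      have h := this ⟨trivial, hX.1, e₁.2 hX.2⟩
      exact ⟨h.1, ⟨h.2.1.2, h.2.2.1.2⟩, e₂.1 h.2.2.2⟩
    · simp only [AllRel, List.forall_mem_cons]
      tauto
  refine he.of_reduction ?_ fun K u v => ?_
  · simp only [weightL, List.map_cons, List.sum_cons, PAtom.edge, Prog.psize,
      if_neg hza, if_neg hzb, hr₂] at hle ⊢
    omega
  · have hu := @satL_update L K
    simp only [SatL, List.forall_mem_cons, evalP, hr₃] at hu ⊢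
    constructor
    · rintro ⟨f, h₁, h₂, h₃, h₄, h₅⟩
      exact ⟨f, h₁, h₂, ⟨f z, h₃, h₄⟩, h₅⟩
    · rintro ⟨f, h₁, h₂, ⟨w, h₃, h₄⟩, h₅⟩
      refine ⟨Function.update f z w, ?_, ?_, ?_, ?_, (hu w hz).2 h₅⟩
      · rwa [Function.update_of_ne hzs.symm]
      · rwa [Function.update_of_ne hzt.symm]
      · rwa [Function.update_self, Function.update_of_ne hza.symm]
      · rwa [Function.update_self, Function.update_of_ne hzb.symm]

end Steps

theorem expressible_of_edge_eq {s t : ℕ} (hst : s ≠ t) {ρ : Prog} (hρ : Prog.In Frag.icpdl ρ) :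
    Expressible [⟨ρ, s, t⟩] s t := by
  refine ⟨ρ, hρ, by simp [weightL]; omega, fun K u v => ?_⟩
  simp only [SatL, List.mem_singleton, forall_eq]
  constructor
  · intro h
    refine ⟨Function.update (fun _ => v) s u, ?_, ?_, ?_⟩ <;>
      simp [Function.update_of_ne hst.symm, h]
  · rintro ⟨f, rfl, rfl, h⟩
    exact h

theorem expressible_nil (s : ℕ) : Expressible [] s s := by
  refine ⟨.eps, trivial, by simp [Prog.psize], fun K u v => ?_⟩
  simp only [SatL, List.not_mem_nil, evalP]
  constructor
  · rintro rfl
    exact ⟨fun _ => u, rfl, rfl, by simp⟩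
  · rintro ⟨f, rfl, h, _⟩
    exact h

theorem expressible_loop {s : ℕ} {ρ : Prog} (hρ : Prog.In Frag.icpdl ρ) :
    Expressible [⟨ρ, s, s⟩] s s := by
  refine ⟨.inter ρ .eps, ⟨trivial, hρ, trivial⟩, by simp [Prog.psize, weightL],
    fun K u v => ?_⟩
  simp only [SatL, List.mem_singleton, forall_eq, evalP]
  constructor
  · rintro ⟨h, rfl⟩
    exact ⟨fun _ => u, rfl, rfl, h⟩
  · rintro ⟨f, rfl, rfl, h⟩
    exact ⟨h, rfl⟩

/-- Elimination of all variables other than `s` and `t`. -/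
theorem expressible_of_elim {S : ℕ → ℕ → Prop} {d : ℕ → ℕ} (hE : Elim S d) {s t : ℕ}
    (hs : d s = 0) (ht : d t = 0) :
    ∀ (n : ℕ) (L : List PAtom), measureL L ≤ n → Admissible S L s t → Expressible L s t := by
  intro n
  induction n using Nat.strong_induction_on with
  | _ n IH =>
  intro L hn hL
  have ih : ∀ L', measureL L' < n → Admissible S L' s t → Expressible L' s t :=
    fun L' h => IH _ h L' le_rfl
  have tr : ∀ L', Similar L L' → measureL L' ≤ n ∧ Admissible S L' s t := fun L' h =>
    ⟨h.measure ▸ hn, h.admissible hE.symm hL⟩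
  have nonloop : ∀ z, ¬ AllRel (fun x y => x = z ↔ y = z) L →
      ∃ ρ a L', Similar L (⟨ρ, z, a⟩ :: L') ∧ a ≠ z := by
    intro z h
    obtain ⟨ρ, a, L', h₁, h₂⟩ := exists_similar_cons hL.inL (z := z)
      (fun _ _ h => h.symm) h (fun x y hx hy => by simp [hx.symm, hy.symm])
    exact ⟨ρ, a, L', h₁, fun h => h₂ (by simp [h])⟩
  by_cases hv : ∃ z, ¬ Fresh z L ∧ z ≠ s ∧ z ≠ t
  · obtain ⟨z, hz, hzs, hzt, hmax⟩ : ∃ z, ¬ Fresh z L ∧ z ≠ s ∧ z ≠ t ∧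
        AllRel (fun x y => d x ≤ d z ∧ d y ≤ d z) L := by
      set W : Finset ℕ := ((L.map PAtom.src ++ L.map PAtom.tgt).toFinset).filter
        fun z => z ≠ s ∧ z ≠ t with hW
      have hmem : ∀ z, z ∈ W ↔ ¬ Fresh z L ∧ z ≠ s ∧ z ≠ t := by
        intro z
        simp only [hW, Finset.mem_filter, List.mem_toFinset, List.mem_append, List.mem_map,
          AllRel, not_forall, not_and_or, not_not]
        refine and_congr_left fun _ => ?_
        constructor
        · rintro (⟨e, he, rfl⟩ | ⟨e, he, rfl⟩)
          · exact ⟨e, he, Or.inl rfl⟩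
          · exact ⟨e, he, Or.inr rfl⟩
        · rintro ⟨e, he, rfl | rfl⟩
          · exact Or.inl ⟨e, he, rfl⟩
          · exact Or.inr ⟨e, he, rfl⟩
      obtain ⟨z₀, hz₀⟩ := hv
      obtain ⟨z, hzW, hzmax⟩ := W.exists_max_image d ⟨z₀, (hmem z₀).2 hz₀⟩
      obtain ⟨h₁, h₂, h₃⟩ := (hmem z).1 hzW
      have hle : ∀ x, ¬ Fresh x L → d x ≤ d z := by
        intro x hx
        by_cases hxs : x = s
        · simp [hxs, hs]
        by_cases hxt : x = t
        · simp [hxt, ht]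
        exact hzmax x ((hmem x).2 ⟨hx, hxs, hxt⟩)
      exact ⟨z, h₁, h₂, h₃, fun e he =>
        ⟨hle _ fun h => (h e he).1 rfl, hle _ fun h => (h e he).2 rfl⟩⟩
    have hmaxsymm : ∀ x y, d x ≤ d z ∧ d y ≤ d z → d y ≤ d z ∧ d x ≤ d z := fun _ _ h => h.symm
    have fsymm : ∀ x y, z ≠ x ∧ z ≠ y → z ≠ y ∧ z ≠ x := fun _ _ h => h.symm
    obtain ⟨ρ, a, L₁, hsim, haz⟩ := nonloop z <| by
      intro h
      obtain ⟨-, h⟩ := hL.conn (· = z) h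
      refine hz fun e he => ?_
      have := h e he
      simp only [hzs.symm, false_iff] at this
      exact ⟨fun h => this.1 h.symm, fun h => this.2 h.symm⟩
    obtain ⟨hn₁, hA₁⟩ := tr _ hsim
    have hSa : S z a := hA₁.rel _ List.mem_cons_self
    have hda : d a ≤ d z := (((hsim.rel _ hmaxsymm).1 hmax) _ List.mem_cons_self).2
    have hin₁ : InL L₁ := (List.forall_mem_cons.1 hA₁.inL).2
    have hρ : Prog.In Frag.icpdl ρ := (List.forall_mem_cons.1 hA₁.inL).1
    by_cases hf₁ : Fresh z L₁
    · exact hsim.expressible (expressible_leaf ih hn₁ hA₁ haz.symm hzs hzt hf₁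
        (hE.clique z a a hSa hSa hda hda))
    obtain ⟨τ, b, L₂, hsim₁, -⟩ := exists_similar_cons hin₁ fsymm hf₁ fun _ _ h h' => ⟨h, h'⟩
    have hsim₂ := hsim.trans (hsim₁.cons (e := ⟨ρ, z, a⟩) hρ)
    obtain ⟨hn₂, hA₂⟩ := tr _ hsim₂
    have hSb : S z b := hA₂.rel _ (List.mem_cons_of_mem _ List.mem_cons_self)
    have hdb : d b ≤ d z := (((hsim₂.rel _ hmaxsymm).1 hmax) _
      (List.mem_cons_of_mem _ List.mem_cons_self)).2
    by_cases hbz : b = z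
    · subst hbz
      have hsim₃ := hsim₂.trans (.of_perm hA₂.inL (.swap _ _ _))
      obtain ⟨hn₃, hA₃⟩ := tr _ hsim₃
      exact hsim₃.expressible (expressible_absorb_loop ih hn₃ hA₃)
    by_cases hba : b = a
    · subst hba
      exact hsim₂.expressible (expressible_merge ih hn₂ hA₂)
    have hin₂ : InL L₂ := (List.forall_mem_cons.1 hsim₁.inL).2
    have hτ : Prog.In Frag.icpdl τ := (List.forall_mem_cons.1 hsim₁.inL).1
    by_cases hf₂ : Fresh z L₂
    · exact hsim₂.expressible (expressible_path ih hn₂ hA₂ haz.symm (Ne.symm hbz) hzs hzt hf₂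
        (hE.clique z a b hSa hSb hda hdb))
    obtain ⟨σ, c, L₃, hsim₃, -⟩ := exists_similar_cons hin₂ fsymm hf₂ fun _ _ h h' => ⟨h, h'⟩
    have hsim₄ := hsim.trans ((hsim₁.trans (hsim₃.cons (e := ⟨τ, z, b⟩) hτ)).cons
      (e := ⟨ρ, z, a⟩) hρ)
    obtain ⟨hn₄, hA₄⟩ := tr _ hsim₄
    have hmem : (⟨σ, z, c⟩ : PAtom) ∈ ⟨ρ, z, a⟩ :: ⟨τ, z, b⟩ :: ⟨σ, z, c⟩ :: L₃ := by simp
    have hSc : S z c := hA₄.rel _ hmem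
    have hdc : d c ≤ d z := (((hsim₄.rel _ hmaxsymm).1 hmax) _ hmem).2
    by_cases hcz : c = z
    · subst hcz
      have hsim₅ := hsim₄.trans (.of_perm hA₄.inL
        (((List.Perm.swap _ _ _).cons _).trans (.swap _ _ _)))
      obtain ⟨hn₅, hA₅⟩ := tr _ hsim₅
      exact hsim₅.expressible (expressible_absorb_loop ih hn₅ hA₅)
    by_cases hca : c = a
    · subst hca
      have hsim₅ := hsim₄.trans (.of_perm hA₄.inL ((List.Perm.swap _ _ _).cons _))
      obtain ⟨hn₅, hA₅⟩ := tr _ hsim₅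
      exact hsim₅.expressible (expressible_merge ih hn₅ hA₅)
    by_cases hcb : c = b
    · subst hcb
      have hsim₅ := hsim₄.trans (.of_perm hA₄.inL
        ((List.Perm.swap _ _ _).trans ((List.Perm.swap _ _ _).cons _)))
      obtain ⟨hn₅, hA₅⟩ := tr _ hsim₅
      exact hsim₅.expressible (expressible_merge ih hn₅ hA₅)
    exact (hE.card z a b c hSa hSb hSc hda hdb hdc haz.symm (Ne.symm hbz) (Ne.symm hcz)
      (Ne.symm hba) (Ne.symm hca) (Ne.symm hcb)).elim
  · have hends : AllRel (fun x y => (x = s ∨ x = t) ∧ (y = s ∨ y = t)) L := by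
      intro e he
      by_contra h
      refine hv ?_
      rw [not_and_or, not_or, not_or] at h
      rcases h with h | h
      · exact ⟨e.src, fun h' => (h' e he).1 rfl, h⟩
      · exact ⟨e.tgt, fun h' => (h' e he).2 rfl, h⟩
    by_cases hst : s = t
    · subst hst
      simp only [or_self] at hends
      match L, hn, hL, hends with
      | [], _, _, _ => exact expressible_nil s
      | [⟨ρ, x, y⟩], _, hL, hends =>
        simp only [AllRel, List.forall_mem_cons] at hends
        obtain ⟨⟨rfl, rfl⟩, -⟩ := hends
        exact expressible_loop (hL.inL _ List.mem_cons_self)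
      | ⟨ρ, x, y⟩ :: ⟨τ, x', y'⟩ :: L, hn, hL, hends =>
        simp only [AllRel, List.forall_mem_cons] at hends
        obtain ⟨⟨rfl, rfl⟩, ⟨rfl, rfl⟩, -⟩ := hends
        exact expressible_merge ih hn hL
    · obtain ⟨ρ, a, L₁, hsim, has⟩ := nonloop s fun h => by
        have := (hL.conn (· = s) h).1
        simp [Ne.symm hst] at this
      have hends₁ := (hsim.rel _ fun _ _ h => And.symm h).1 hends
      obtain rfl : a = t := (hends₁ _ List.mem_cons_self).2.resolve_left has
      obtain ⟨hn₁, hA₁⟩ := tr _ hsim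
      have hρ : Prog.In Frag.icpdl ρ := hA₁.inL _ List.mem_cons_self
      match L₁, hsim, hn₁, hA₁, hends₁ with
      | [], hsim, _, _, _ => exact hsim.expressible (expressible_of_edge_eq hst hρ)
      | ⟨τ, x, y⟩ :: L₂, hsim, hn₁, hA₁, hends₁ =>
        have hxy := hends₁ _ (List.mem_cons_of_mem _ List.mem_cons_self)
        simp only at hxy
        have hsim₂ := hsim.trans (.of_perm hA₁.inL (.swap _ _ _))
        obtain ⟨hn₂, hA₂⟩ := tr _ hsim₂
        obtain ⟨rfl | rfl, rfl | rfl⟩ := hxy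
        · exact hsim₂.expressible (expressible_absorb_loop ih hn₂ hA₂)
        · exact hsim.expressible (expressible_merge ih hn₁ hA₁)
        · have hsim₃ := hsim₂.trans (.flip hA₂.inL)
          obtain ⟨hn₃, hA₃⟩ := tr _ hsim₃
          exact hsim₃.expressible (expressible_merge ih hn₃ hA₃)
        · have hsim₃ := ((hsim.trans (.flip hA₁.inL)).trans
            (.of_perm (Similar.flip hA₁.inL).inL (.swap _ _ _)))
          obtain ⟨hn₃, hA₃⟩ := tr _ hsim₃
          exact hsim₃.expressible (expressible_absorb_loop ih hn₃ hA₃)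

/-! ## Linear translations -/

/-- A formula of `F` equivalent to `φ` over Kripke structures, of size at most `n`. -/
def FmlExpr (F : Frag) (φ : Fml) (n : ℕ) : Prop :=
  ∃ φ', Fml.In F φ' ∧ (∀ K : Struct, K.IsKripke → ∀ w, evalF K φ w ↔ evalF K φ' w) ∧
    φ'.fsize ≤ n

/-- A program of `F` equivalent to `π` over Kripke structures, of size at most `n`. -/
def ProgExpr (F : Frag) (π : Prog) (n : ℕ) : Prop :=
  ∃ π', Prog.In F π' ∧ (∀ K : Struct, K.IsKripke → ∀ u v, evalP K π u v ↔ evalP K π' u v) ∧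
    π'.psize ≤ n

/-- Translations of linear size. -/
structure LinTrans (F₁ F₂ : Frag) (c : ℕ) : Prop where
  fml : ∀ φ, Fml.In F₁ φ → FmlExpr F₂ φ (c * φ.fsize)
  prog : ∀ π, Prog.In F₁ π → ProgExpr F₂ π (c * π.psize)

theorem LinTrans.trans {F₁ F₂ F₃ : Frag} {c c' : ℕ} (h : LinTrans F₁ F₂ c)
    (h' : LinTrans F₂ F₃ c') : LinTrans F₁ F₃ (c' * c) where
  fml φ hφ := by
    obtain ⟨φ₁, h₁, h₂, h₃⟩ := h.fml φ hφ
    obtain ⟨φ₂, h₄, h₅, h₆⟩ := h'.fml φ₁ h₁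
    refine ⟨φ₂, h₄, fun K hK w => (h₂ K hK w).trans (h₅ K hK w), h₆.trans ?_⟩
    rw [mul_assoc]
    exact Nat.mul_le_mul_left _ h₃
  prog π hπ := by
    obtain ⟨π₁, h₁, h₂, h₃⟩ := h.prog π hπ
    obtain ⟨π₂, h₄, h₅, h₆⟩ := h'.prog π₁ h₁
    refine ⟨π₂, h₄, fun K hK u v => (h₂ K hK u v).trans (h₅ K hK u v), h₆.trans ?_⟩
    rw [mul_assoc]
    exact Nat.mul_le_mul_left _ h₃

theorem LinTrans.translatable {F₁ F₂ : Frag} {c : ℕ} (h : LinTrans F₁ F₂ (c + 1)) :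
    Translatable F₁ F₂ := by
  classical
  have hf : ∀ φ, ∃ φ', Fml.In F₁ φ → Fml.In F₂ φ' ∧
      (∀ K : Struct, K.IsKripke → ∀ w, evalF K φ w ↔ evalF K φ' w) ∧
      φ'.fsize ≤ (c + 1) * φ.fsize := by
    intro φ
    by_cases hφ : Fml.In F₁ φ
    · obtain ⟨φ', h'⟩ := h.fml φ hφ
      exact ⟨φ', fun _ => h'⟩
    · exact ⟨φ, fun h => absurd h hφ⟩
  have hp : ∀ π, ∃ π', Prog.In F₁ π → Prog.In F₂ π' ∧
      (∀ K : Struct, K.IsKripke → ∀ u v, evalP K π u v ↔ evalP K π' u v) ∧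
      π'.psize ≤ (c + 1) * π.psize := by
    intro π
    by_cases hπ : Prog.In F₁ π
    · obtain ⟨π', h'⟩ := h.prog π hπ
      exact ⟨π', fun _ => h'⟩
    · exact ⟨π, fun h => absurd h hπ⟩
  have bound : ∀ s : ℕ, (c + 1) * s ≤ (c + 1) * (s + 1) ^ (c + 1) := fun s =>
    Nat.mul_le_mul_left _ ((Nat.le_succ s).trans (Nat.le_self_pow (Nat.succ_ne_zero c) _))
  choose tf htf using hf
  choose tp htp using hp
  exact ⟨tf, tp, fun φ hφ => ⟨(htf φ hφ).1, (htf φ hφ).2.1⟩,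
    fun π hπ => ⟨(htp π hπ).1, (htp π hπ).2.1⟩, c + 1,
    fun φ hφ => (htf φ hφ).2.2.trans (bound _), fun π hπ => (htp π hπ).2.2.trans (bound _)⟩

/-! ## Monotonicity in the tree-width -/

theorem TreewidthLE.mono {α : Type} {V : Set α} {adj : α → α → Prop} {k l : ℕ} (hkl : k ≤ l)
    (h : TreewidthLE V adj k) : TreewidthLE V adj l := by
  obtain ⟨td, htd⟩ := h
  exact ⟨td, fun b => ⟨(htd b).1, (htd b).2.trans (by omega)⟩⟩

mutual
theorem Fml.In.tw_mono {k l : ℕ} (hkl : k ≤ l) :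
    ∀ φ : Fml, Fml.In (Frag.tw k) φ → Fml.In (Frag.tw l) φ
  | .prop _, _ => trivial
  | .neg φ, h => by
    simp only [Fml.In] at h ⊢
    exact Fml.In.tw_mono hkl φ h
  | .and φ ψ, h => by
    simp only [Fml.In] at h ⊢
    exact ⟨Fml.In.tw_mono hkl φ h.1, Fml.In.tw_mono hkl ψ h.2⟩
  | .diam π, h => by
    simp only [Fml.In] at h ⊢
    exact Prog.In.tw_mono hkl π h
  | .loop π, h => by simp [Fml.In, Frag.tw] at h
theorem Prog.In.tw_mono {k l : ℕ} (hkl : k ≤ l) :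
    ∀ π : Prog, Prog.In (Frag.tw k) π → Prog.In (Frag.tw l) π
  | .eps, _ => trivial
  | .atom _, _ => trivial
  | .conv _, _ => trivial
  | .union π₁ π₂, h => by
    simp only [Prog.In] at h ⊢
    exact ⟨Prog.In.tw_mono hkl π₁ h.1, Prog.In.tw_mono hkl π₂ h.2⟩
  | .comp π₁ π₂, h => by
    simp only [Prog.In] at h ⊢
    exact ⟨Prog.In.tw_mono hkl π₁ h.1, Prog.In.tw_mono hkl π₂ h.2⟩
  | .star π, h => by
    simp only [Prog.In] at h ⊢
    exact Prog.In.tw_mono hkl π h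
  | .test φ, h => by
    simp only [Prog.In] at h ⊢
    exact Fml.In.tw_mono hkl φ h
  | .inter _ _, h => by simp [Prog.In, Frag.tw] at h
  | .univ, h => by simp [Prog.In, Frag.tw] at h
  | .cq ps rs xs xt, h => by
    simp only [Prog.In] at h ⊢
    exact ⟨TreewidthLE.mono hkl h.1, h.2.1, PList.In.tw_mono hkl ps h.2.2⟩
theorem PList.In.tw_mono {k l : ℕ} (hkl : k ≤ l) :
    ∀ ps : PList, PList.In (Frag.tw k) ps → PList.In (Frag.tw l) ps
  | .nil, _ => trivial
  | .cons π _ _ ps, h => by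
    simp only [PList.In] at h ⊢
    exact ⟨Prog.In.tw_mono hkl π h.1, PList.In.tw_mono hkl ps h.2⟩
end

theorem linTrans_tw_mono {k l : ℕ} (hkl : k ≤ l) : LinTrans (Frag.tw k) (Frag.tw l) 1 where
  fml φ hφ := ⟨φ, Fml.In.tw_mono hkl φ hφ, fun _ _ _ => Iff.rfl, by omega⟩
  prog π hπ := ⟨π, Prog.In.tw_mono hkl π hπ, fun _ _ _ _ => Iff.rfl, by omega⟩

/-! ## Intersections as conjunctive programs -/

theorem treewidthLE_one_of_pair {V : Set ℕ} {adj : ℕ → ℕ → Prop} {x y : ℕ}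
    (hV : ∀ v ∈ V, v = x ∨ v = y)
    (hadj : ∀ u v, adj u v → (u = x ∨ u = y) ∧ (v = x ∨ v = y)) : TreewidthLE V adj 1 := by
  refine ⟨⟨Unit, ⊥, .of_subsingleton, fun _ => {x, y}, fun v hv => ⟨(), hV v hv⟩,
    fun u v h => ⟨(), hadj u v h⟩, fun v _ _ hv _ => ⟨.nil, fun _ _ => hv⟩⟩, fun _ => ⟨?_, ?_⟩⟩
  · exact Set.toFinite _
  · exact (Set.ncard_insert_le x {y}).trans (by simp)

theorem progExpr_inter {π₁ π₂ : Prog} {n₁ n₂ : ℕ} (h₁ : ProgExpr (Frag.tw 1) π₁ n₁)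
    (h₂ : ProgExpr (Frag.tw 1) π₂ n₂) :
    ProgExpr (Frag.tw 1) (.inter π₁ π₂) (n₁ + n₂ + 2) := by
  obtain ⟨ρ₁, a₁, b₁, c₁⟩ := h₁
  obtain ⟨ρ₂, a₂, b₂, c₂⟩ := h₂
  have hco : ∀ x y, atomAdj (.cons ρ₁ 0 1 (.cons ρ₂ 0 1 .nil)) [] x y ↔
      (x = 0 ∨ x = 1) ∧ (y = 0 ∨ y = 1) := by
    intro x y
    simp [atomAdj, PList.coOcc]
  have hvars : ∀ x, x ∈ cqVars (.cons ρ₁ 0 1 (.cons ρ₂ 0 1 .nil)) [] ↔ x = 0 ∨ x = 1 := by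
    intro x
    simp only [cqVars, PList.vars, List.map_nil, List.flatten_nil, List.append_nil,
      List.mem_cons, List.not_mem_nil]
    tauto
  refine ⟨.cq (.cons ρ₁ 0 1 (.cons ρ₂ 0 1 .nil)) [] 0 1, ?_, fun K hK u v => ?_, ?_⟩
  · simp only [Prog.In, PList.In]
    refine ⟨?_, ⟨?_, ?_, ?_, ?_⟩, a₁, a₂, trivial⟩
    · refine treewidthLE_one_of_pair (x := 0) (y := 1) (fun v hv => (hvars v).1 hv) ?_
      rintro x y (h | ⟨rfl, rfl⟩ | ⟨rfl, rfl⟩)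
      · exact (hco x y).1 h
      · simp
      · simp
    · simp [hvars]
    · simp [hvars]
    · simp
    · intro x hx y hy
      exact .single ((hco x y).2 ⟨(hvars x).1 hx, (hvars y).1 hy⟩)
  · simp only [evalP, evalPL, b₁ K hK, b₂ K hK]
    constructor
    · rintro ⟨h, h'⟩
      exact ⟨fun n => if n = 0 then u else v, by simp, by simp, by simp [h, h'], by simp⟩
    · rintro ⟨f, rfl, rfl, ⟨h, h', -⟩, -⟩
      exact ⟨h, h'⟩
  · simp only [Prog.psize, PList.plsize, ratomSize, List.map_nil, List.sum_nil]
    omega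

/-! ## Translations commute with the common connectives -/

section Connectives

variable {F : Frag} {φ ψ : Fml} {π ρ : Prog} {m n : ℕ}

theorem FmlExpr.mono (h : FmlExpr F φ m) (hmn : m ≤ n) : FmlExpr F φ n := by
  obtain ⟨φ', h₁, h₂, h₃⟩ := h
  exact ⟨φ', h₁, h₂, h₃.trans hmn⟩

theorem ProgExpr.mono (h : ProgExpr F π m) (hmn : m ≤ n) : ProgExpr F π n := by
  obtain ⟨π', h₁, h₂, h₃⟩ := h
  exact ⟨π', h₁, h₂, h₃.trans hmn⟩

theorem FmlExpr.neg (h : FmlExpr F φ m) : FmlExpr F (.neg φ) (1 + m) := by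
  obtain ⟨φ', h₁, h₂, h₃⟩ := h
  refine ⟨.neg φ', by simpa only [Fml.In] using h₁, fun K hK w => ?_, ?_⟩
  · simp only [evalF, h₂ K hK]
  · simp only [Fml.fsize]
    omega

theorem FmlExpr.and (h : FmlExpr F φ m) (h' : FmlExpr F ψ n) :
    FmlExpr F (.and φ ψ) (m + n) := by
  obtain ⟨φ', h₁, h₂, h₃⟩ := h
  obtain ⟨ψ', h₁', h₂', h₃'⟩ := h'
  refine ⟨.and φ' ψ', by simpa only [Fml.In] using ⟨h₁, h₁'⟩, fun K hK w => ?_, ?_⟩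
  · simp only [evalF, h₂ K hK, h₂' K hK]
  · simp only [Fml.fsize]
    omega

theorem ProgExpr.diam (h : ProgExpr F π m) : FmlExpr F (.diam π) (1 + m) := by
  obtain ⟨π', h₁, h₂, h₃⟩ := h
  refine ⟨.diam π', by simpa only [Fml.In] using h₁, fun K hK w => ?_, ?_⟩
  · simp only [evalF, h₂ K hK]
  · simp only [Fml.fsize]
    omega

theorem FmlExpr.test (h : FmlExpr F φ m) : ProgExpr F (.test φ) (1 + m) := by
  obtain ⟨φ', h₁, h₂, h₃⟩ := h
  refine ⟨.test φ', by simpa only [Prog.In] using h₁, fun K hK u v => ?_, ?_⟩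
  · simp only [evalP, h₂ K hK]
  · simp only [Prog.psize]
    omega

theorem ProgExpr.union (h : ProgExpr F π m) (h' : ProgExpr F ρ n) :
    ProgExpr F (.union π ρ) (m + n) := by
  obtain ⟨π', h₁, h₂, h₃⟩ := h
  obtain ⟨ρ', h₁', h₂', h₃'⟩ := h'
  refine ⟨.union π' ρ', by simpa only [Prog.In] using ⟨h₁, h₁'⟩, fun K hK u v => ?_, ?_⟩
  · simp only [evalP, h₂ K hK, h₂' K hK]
  · simp only [Prog.psize]
    omega

theorem ProgExpr.comp (h : ProgExpr F π m) (h' : ProgExpr F ρ n) :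
    ProgExpr F (.comp π ρ) (m + n) := by
  obtain ⟨π', h₁, h₂, h₃⟩ := h
  obtain ⟨ρ', h₁', h₂', h₃'⟩ := h'
  refine ⟨.comp π' ρ', by simpa only [Prog.In] using ⟨h₁, h₁'⟩, fun K hK u v => ?_, ?_⟩
  · simp only [evalP, h₂ K hK, h₂' K hK]
  · simp only [Prog.psize]
    omega

theorem ProgExpr.star (h : ProgExpr F π m) : ProgExpr F (.star π) (1 + m) := by
  obtain ⟨π', h₁, h₂, h₃⟩ := h
  refine ⟨.star π', by simpa only [Prog.In] using h₁, fun K hK u v => ?_, ?_⟩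
  · simp only [evalP, h₂ K hK]
  · simp only [Prog.psize]
    omega

end Connectives

/-! ## From ICPDL to CPDL⁺(TW₁) -/

mutual
theorem fmlExpr_tw_one : ∀ φ : Fml, Fml.In Frag.icpdl φ →
    ∃ n, n + 2 ≤ 3 * φ.fsize ∧ FmlExpr (Frag.tw 1) φ n
  | .prop p, _ => ⟨1, by simp [Fml.fsize], .prop p, trivial, fun _ _ _ => Iff.rfl, le_rfl⟩
  | .neg φ, h => by
    simp only [Fml.In] at h
    obtain ⟨n, hn, h'⟩ := fmlExpr_tw_one φ h
    exact ⟨_, by simp only [Fml.fsize]; omega, h'.neg⟩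
  | .and φ ψ, h => by
    simp only [Fml.In] at h
    obtain ⟨n, hn, h₁⟩ := fmlExpr_tw_one φ h.1
    obtain ⟨m, hm, h₂⟩ := fmlExpr_tw_one ψ h.2
    exact ⟨_, by simp only [Fml.fsize]; omega, h₁.and h₂⟩
  | .diam π, h => by
    simp only [Fml.In] at h
    obtain ⟨n, hn, h'⟩ := progExpr_tw_one π h
    exact ⟨_, by simp only [Fml.fsize]; omega, h'.diam⟩
  | .loop π, h => by simp [Fml.In, Frag.icpdl] at h
theorem progExpr_tw_one : ∀ π : Prog, Prog.In Frag.icpdl π →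
    ∃ n, n + 2 ≤ 3 * π.psize ∧ ProgExpr (Frag.tw 1) π n
  | .eps, _ => ⟨1, by simp [Prog.psize], .eps, trivial, fun _ _ _ _ => Iff.rfl, le_rfl⟩
  | .atom a, _ => ⟨1, by simp [Prog.psize], .atom a, trivial, fun _ _ _ _ => Iff.rfl, le_rfl⟩
  | .conv a, _ => ⟨1, by simp [Prog.psize], .conv a, trivial, fun _ _ _ _ => Iff.rfl, le_rfl⟩
  | .union π₁ π₂, h => by
    simp only [Prog.In] at h
    obtain ⟨n, hn, h₁⟩ := progExpr_tw_one π₁ h.1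
    obtain ⟨m, hm, h₂⟩ := progExpr_tw_one π₂ h.2
    exact ⟨_, by simp only [Prog.psize]; omega, h₁.union h₂⟩
  | .comp π₁ π₂, h => by
    simp only [Prog.In] at h
    obtain ⟨n, hn, h₁⟩ := progExpr_tw_one π₁ h.1
    obtain ⟨m, hm, h₂⟩ := progExpr_tw_one π₂ h.2
    exact ⟨_, by simp only [Prog.psize]; omega, h₁.comp h₂⟩
  | .star π, h => by
    simp only [Prog.In] at h
    obtain ⟨n, hn, h'⟩ := progExpr_tw_one π h
    exact ⟨_, by simp only [Prog.psize]; omega, h'.star⟩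
  | .test φ, h => by
    simp only [Prog.In] at h
    obtain ⟨n, hn, h'⟩ := fmlExpr_tw_one φ h
    exact ⟨_, by simp only [Prog.psize]; omega, h'.test⟩
  | .inter π₁ π₂, h => by
    simp only [Prog.In] at h
    obtain ⟨n, hn, h₁⟩ := progExpr_tw_one π₁ h.2.1
    obtain ⟨m, hm, h₂⟩ := progExpr_tw_one π₂ h.2.2
    exact ⟨_, by simp only [Prog.psize]; omega, progExpr_inter h₁ h₂⟩
  | .univ, h => by simp [Prog.In, Frag.icpdl] at h
  | .cq .., h => by simp [Prog.In, Frag.icpdl] at h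
end

theorem linTrans_icpdl_tw_one : LinTrans Frag.icpdl (Frag.tw 1) 3 where
  fml φ hφ := by
    obtain ⟨n, hn, h⟩ := fmlExpr_tw_one φ hφ
    exact h.mono (by omega)
  prog π hπ := by
    obtain ⟨n, hn, h⟩ := progExpr_tw_one π hπ
    exact h.mono (by omega)

/-! ## From CPDL⁺(TW₂) to ICPDL -/

/-- The ICPDL atoms `L` express the p-atoms `ps`, on the same pairs of variables. -/
structure AtomsExpr (ps : PList) (L : List PAtom) : Prop where
  inL : InL L
  eval : ∀ K : Struct, K.IsKripke → ∀ f : ℕ → K.World, evalPL K f ps ↔ SatL K f L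
  weight : weightL L + L.length ≤ 5 * ps.plsize
  coOcc : ∀ x y, ps.coOcc x y ↔ ∃ e ∈ L, (x = e.src ∨ x = e.tgt) ∧ (y = e.src ∨ y = e.tgt)
  vars : ∀ x, x ∈ ps.vars ↔ ∃ e ∈ L, x = e.src ∨ x = e.tgt

theorem AtomsExpr.nil : AtomsExpr .nil [] := by
  refine ⟨?_, ?_, ?_, ?_, ?_⟩ <;>
    simp [InL, evalPL, SatL, weightL, PList.coOcc, PList.vars]

theorem AtomsExpr.cons {π : Prog} {ps : PList} {L : List PAtom} (x y : ℕ)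
    (hπ : ProgExpr Frag.icpdl π (5 * π.psize)) (h : AtomsExpr ps L) :
    ∃ L', AtomsExpr (.cons π x y ps) L' := by
  obtain ⟨π', h₁, h₂, h₃⟩ := hπ
  have hle : (PAtom.mk π' x y).edge ≤ 1 := by
    unfold PAtom.edge
    split <;> omega
  refine ⟨⟨π', x, y⟩ :: L, List.forall_mem_cons.2 ⟨h₁, h.inL⟩, fun K hK f => ?_, ?_,
    fun a b => ?_, fun a => ?_⟩
  · have := h.eval K hK f
    simp only [SatL, List.forall_mem_cons, evalPL] at this ⊢
    rw [this, h₂ K hK]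
  · have := h.weight
    simp only [weightL, List.map_cons, List.sum_cons, PList.plsize, List.length_cons] at this ⊢
    omega
  · simp only [PList.coOcc, List.exists_mem_cons_iff, h.coOcc]
  · rw [List.exists_mem_cons_iff, or_assoc, ← h.vars, PList.vars, List.mem_cons, List.mem_cons]

theorem AtomsExpr.progExpr_cq {ps : PList} {L : List PAtom} {s t : ℕ} (h : AtomsExpr ps L)
    (htw : TreewidthLE {x | x ∈ cqVars ps []} (ugAdj ps [] s t) 2) (hwf : cqWF ps [] s t) :
    ProgExpr Frag.icpdl (.cq ps [] s t) (5 * (Prog.cq ps [] s t).psize) := by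
  obtain ⟨S, d, hE, hS, hs, ht⟩ := exists_elim htw (s := s) (t := t) (Or.inr (Or.inl ⟨rfl, rfl⟩))
  obtain ⟨hs', ht', -, hconn⟩ := hwf
  have hvars : ∀ x, x ∈ cqVars ps [] ↔ ∃ e ∈ L, x = e.src ∨ x = e.tgt := by
    intro x
    simp [cqVars, h.vars]
  have hadj : ∀ x y, atomAdj ps [] x y ↔
      ∃ e ∈ L, (x = e.src ∨ x = e.tgt) ∧ (y = e.src ∨ y = e.tgt) := by
    intro x y
    simp [atomAdj, h.coOcc]
  have hA : Admissible S L s t := by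
    refine ⟨h.inL, fun X hX => ?_, fun e he => hS _ _ (Or.inl ((hadj _ _).2 ⟨e, he, by simp⟩))⟩
    have step : ∀ x y, Relation.ReflTransGen (atomAdj ps []) x y → (X x ↔ X y) := by
      intro x y hxy
      induction hxy with
      | refl => rfl
      | tail _ hbc ih =>
        obtain ⟨e, he, hb, hc⟩ := (hadj _ _).1 hbc
        have := hX e he
        rw [ih]
        rcases hb with rfl | rfl <;> rcases hc with rfl | rfl <;> tauto
    have reach : ∀ x ∈ cqVars ps [], (X s ↔ X x) := fun x hx => step s x (hconn s hs' x hx)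
    exact ⟨reach t ht', fun e he => ⟨reach _ ((hvars _).2 ⟨e, he, by simp⟩),
      reach _ ((hvars _).2 ⟨e, he, by simp⟩)⟩⟩
  obtain ⟨π, h₁, h₂, h₃⟩ := expressible_of_elim hE hs ht _ L le_rfl hA
  refine ⟨π, h₁, fun K hK u v => ?_, ?_⟩
  · rw [h₃]
    simp [evalP, h.eval K hK]
  · obtain ⟨e, he, -⟩ := (hvars s).1 hs'
    have hlen : 0 < L.length := List.length_pos_of_mem he
    have := h.weight
    simp only [Prog.psize, ratomSize, List.map_nil, List.sum_nil]
    omega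

theorem progExpr_cq_of_ratom {ps : PList} {r : RAtom} {rs : List RAtom} {s t : ℕ}
    (hr : 2 < r.args.length) :
    ProgExpr Frag.icpdl (.cq ps (r :: rs) s t) (5 * (Prog.cq ps (r :: rs) s t).psize) := by
  refine ⟨.test (.and (.prop 0) (.neg (.prop 0))), ?_, fun K hK u v => ?_, ?_⟩
  · simp [Prog.In, Fml.In]
  · simp only [evalP, evalF, and_not_self, and_false, iff_false]
    rintro ⟨f, -, -, -, h⟩
    exact hK _ hr _ _ (h r List.mem_cons_self)
  · simp only [Prog.psize, Fml.fsize, ratomSize, List.map_cons, List.sum_cons]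
    omega

mutual
theorem fmlExpr_icpdl : ∀ φ : Fml, Fml.In (Frag.tw 2) φ →
    FmlExpr Frag.icpdl φ (5 * φ.fsize)
  | .prop p, _ => ⟨.prop p, trivial, fun _ _ _ => Iff.rfl, by simp [Fml.fsize]⟩
  | .neg φ, h => by
    simp only [Fml.In] at h
    exact (fmlExpr_icpdl φ h).neg.mono (by simp only [Fml.fsize]; omega)
  | .and φ ψ, h => by
    simp only [Fml.In] at h
    exact ((fmlExpr_icpdl φ h.1).and (fmlExpr_icpdl ψ h.2)).mono
      (by simp only [Fml.fsize]; omega)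
  | .diam π, h => by
    simp only [Fml.In] at h
    exact (progExpr_icpdl π h).diam.mono (by simp only [Fml.fsize]; omega)
  | .loop π, h => by simp [Fml.In, Frag.tw] at h
theorem progExpr_icpdl : ∀ π : Prog, Prog.In (Frag.tw 2) π →
    ProgExpr Frag.icpdl π (5 * π.psize)
  | .eps, _ => ⟨.eps, trivial, fun _ _ _ _ => Iff.rfl, by simp [Prog.psize]⟩
  | .atom a, _ => ⟨.atom a, trivial, fun _ _ _ _ => Iff.rfl, by simp [Prog.psize]⟩
  | .conv a, _ => ⟨.conv a, trivial, fun _ _ _ _ => Iff.rfl, by simp [Prog.psize]⟩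
  | .union π₁ π₂, h => by
    simp only [Prog.In] at h
    exact ((progExpr_icpdl π₁ h.1).union (progExpr_icpdl π₂ h.2)).mono
      (by simp only [Prog.psize]; omega)
  | .comp π₁ π₂, h => by
    simp only [Prog.In] at h
    exact ((progExpr_icpdl π₁ h.1).comp (progExpr_icpdl π₂ h.2)).mono
      (by simp only [Prog.psize]; omega)
  | .star π, h => by
    simp only [Prog.In] at h
    exact (progExpr_icpdl π h).star.mono (by simp only [Prog.psize]; omega)
  | .test φ, h => by
    simp only [Prog.In] at h
    exact (fmlExpr_icpdl φ h).test.mono (by simp only [Prog.psize]; omega)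
  | .inter _ _, h => by simp [Prog.In, Frag.tw] at h
  | .univ, h => by simp [Prog.In, Frag.tw] at h
  | .cq ps [] s t, h => by
    simp only [Prog.In] at h
    obtain ⟨L, hL⟩ := exists_atomsExpr ps h.2.2
    exact hL.progExpr_cq h.1 h.2.1
  | .cq ps (r :: rs) s t, h => by
    simp only [Prog.In] at h
    exact progExpr_cq_of_ratom (h.2.1.2.2.1 r List.mem_cons_self)
theorem exists_atomsExpr : ∀ ps : PList, PList.In (Frag.tw 2) ps → ∃ L, AtomsExpr ps L
  | .nil, _ => ⟨[], .nil⟩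
  | .cons π x y ps, h => by
    simp only [PList.In] at h
    obtain ⟨L, hL⟩ := exists_atomsExpr ps h.2
    exact hL.cons x y (progExpr_icpdl π h.1)
end

theorem linTrans_tw_two_icpdl : LinTrans (Frag.tw 2) Frag.icpdl 5 :=
  ⟨fmlExpr_icpdl, progExpr_icpdl⟩

/-- Over Kripke structures, the logics ICPDL, CPDL⁺(TW₁) and
CPDL⁺(TW₂) are pairwise equi-expressive: in each direction there is a
(polynomial-time computable) translation mapping formulas to formulas and
programs to programs which preserves semantic equivalence on all Kripke
structures. -/
theorem statement_0 :
    Translatable Frag.icpdl (Frag.tw 1) ∧ Translatable (Frag.tw 1) Frag.icpdl ∧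
    Translatable Frag.icpdl (Frag.tw 2) ∧ Translatable (Frag.tw 2) Frag.icpdl ∧
    Translatable (Frag.tw 1) (Frag.tw 2) ∧ Translatable (Frag.tw 2) (Frag.tw 1) := by
  have h₁ := linTrans_icpdl_tw_one
  have h₂ : LinTrans (Frag.tw 1) (Frag.tw 2) 1 := linTrans_tw_mono one_le_two
  have h₃ := linTrans_tw_two_icpdl
  exact ⟨h₁.translatable, (h₂.trans h₃).translatable, (h₁.trans h₂).translatable,
    h₃.translatable, h₂.translatable, (h₃.trans h₁).translatable⟩

end PaperCPDL
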